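/- arXiv:2110.02836 — 6 statements merged into one kernel-verified Lean document; each statement's English description precedes it below -/
import Mathlib

section
/- Let Θ be a finite set, and let p and q be probability mass functions on Θ (p the transcript distribution in the real world, q in the ideal world). Let Θ_b ⊆ Θ be a set of 'bad' transcripts and let ε_ratio ≥ 0 and ε_bad ≥ 0 be real numbers. Suppose that p(τ) ≥ (1 − ε_ratio)·q(τ) for every τ ∈ Θ \ Θ_b, and that q(Θ_b) = ∑_{τ∈Θ_b} q(τ) ≤ ε_bad. Then for every subset S ⊆ Θ, p(S) − q(S) ≤ ε_ratio + ε_bad (so in particular the distinguishing advantage |p(S) − q(S)| of any event S is at most ε_ratio + ε_bad). -/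
/-- H-coefficient technique: if the real-world transcript pmf `p` satisfies
`p τ ≥ (1 − ε_ratio) * q τ` on all good transcripts, and the ideal-world pmf `q`
puts mass at most `ε_bad` on the bad transcripts `Θb`, then for every event `S`
the advantage `p(S) − q(S)` is at most `ε_ratio + ε_bad`. -/
theorem hcoefficient_technique {Θ : Type*} [Fintype Θ]
    (p q : Θ → ℝ)
    (hp0 : ∀ τ, 0 ≤ p τ) (hp1 : ∑ τ, p τ = 1)
    (hq0 : ∀ τ, 0 ≤ q τ) (hq1 : ∑ τ, q τ = 1)
    (Θb : Finset Θ) (εratio εbad : ℝ)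
    (hεr : 0 ≤ εratio) (hεb : 0 ≤ εbad)
    (hgood : ∀ τ, τ ∉ Θb → p τ ≥ (1 - εratio) * q τ)
    (hbad : ∑ τ ∈ Θb, q τ ≤ εbad) :
    ∀ S : Finset Θ, (∑ τ ∈ S, p τ) - (∑ τ ∈ S, q τ) ≤ εratio + εbad := by
  classical
  intro S
  have hp := Finset.sum_add_sum_compl S p
  have hq := Finset.sum_add_sum_compl S q
  have hpoint : ∀ τ, q τ - p τ ≤ εratio * q τ + if τ ∈ Θb then q τ else 0 := by
    intro τ
    have hmul := mul_nonneg hεr (hq0 τ)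
    split_ifs with h
    · linarith [hp0 τ]
    · linarith [hgood τ h]
  have hcompl : ∑ τ ∈ Sᶜ, (q τ - p τ) ≤ εratio + ∑ τ ∈ Θb, q τ :=
    calc ∑ τ ∈ Sᶜ, (q τ - p τ)
        ≤ ∑ τ ∈ Sᶜ, (εratio * q τ + if τ ∈ Θb then q τ else 0) :=
          Finset.sum_le_sum fun τ _ => hpoint τ
      _ ≤ ∑ τ, (εratio * q τ + if τ ∈ Θb then q τ else 0) := by
          refine Finset.sum_le_univ_sum_of_nonneg fun τ => ?_
          have hmul := mul_nonneg hεr (hq0 τ)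
          split_ifs
          · linarith [hq0 τ]
          · linarith
      _ = εratio + ∑ τ ∈ Θb, q τ := by
          rw [Finset.sum_add_distrib, ← Finset.mul_sum, hq1, mul_one, Finset.sum_ite_mem,
            Finset.univ_inter]
  rw [Finset.sum_sub_distrib] at hcompl
  linarith
end

section
/- Let ι be a finite type with |ι| = N ≥ 1, let κ be a type, let c be a positive integer, and let f, f' : ι → κ be functions such that |{x ∈ ι : f(x) ≠ f'(x)}| ≤ α·N for some real α ≥ 0. In the complex Euclidean space indexed by functions g : Fin c → ι × κ, define ψ by ψ(g) = N^{−c/2} if (g i).2 = f((g i).1) for every i ∈ Fin c and ψ(g) = 0 otherwise, and define ψ' analogously with f' in place of f. Then ‖ψ − ψ'‖² ≤ 2·c·α. -/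
theorem norm_sq_ite_sub_ite (p q : Prop) [Decidable p] [Decidable q] (a : ℝ) :
    ‖(if p then (a : ℂ) else 0) - (if q then (a : ℂ) else 0)‖ ^ 2 =
      a ^ 2 * ((if p ∧ ¬ q then 1 else 0) + (if q ∧ ¬ p then 1 else 0)) := by
  by_cases hp : p <;> by_cases hq : q <;> simp [hp, hq]

open Finset in
/-- The tuples whose `i`-th entry lies in `B` make up a fraction `|B| / |ι|` of all tuples. -/
theorem card_filter_apply_mem_mul_card {ι : Type*} [Fintype ι] [DecidableEq ι] {c : ℕ}
    (i : Fin c) (B : Finset ι) :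
    #{x : Fin c → ι | x i ∈ B} * Fintype.card ι = #B * Fintype.card ι ^ c := by
  have h : ({x : Fin c → ι | x i ∈ B} : Finset (Fin c → ι)) =
      Fintype.piFinset (Function.update (fun _ => univ) i B) := by
    ext x
    simp only [mem_filter, mem_univ, true_and, Fintype.mem_piFinset]
    refine ⟨fun hx j => ?_, fun hx => by simpa using hx i⟩
    by_cases hj : j = i
    · subst hj
      simpa using hx
    · simp [hj]
  have hupd (j : Fin c) : #(Function.update (fun _ => (univ : Finset ι)) i B j) =
      Function.update (fun _ => Fintype.card ι) i #B j := by
    by_cases hj : j = i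
    · subst hj
      simp
    · simp [hj]
  rw [h, Fintype.card_piFinset, prod_congr rfl fun j _ => hupd j,
    prod_update_of_mem (mem_univ i), prod_const, mul_assoc, ← pow_succ,
    card_sdiff_of_subset (subset_univ _), card_singleton, card_univ, Fintype.card_fin,
    Nat.sub_add_cancel (Nat.one_le_of_lt i.isLt)]

open Finset in
/-- Union bound: few tuples of pairs lie on the graph of `f` in every coordinate
but off the graph of `f'` in some coordinate. -/
theorem card_graph_tuples_sdiff_mul_card_le {ι κ : Type*} [Fintype ι] [Fintype κ]
    [DecidableEq ι] [DecidableEq κ] {c : ℕ} (f f' : ι → κ) :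
    #{g : Fin c → ι × κ | (∀ i, (g i).2 = f (g i).1) ∧ ¬ ∀ i, (g i).2 = f' (g i).1} *
      Fintype.card ι ≤ c * (#{x : ι | f x ≠ f' x} * Fintype.card ι ^ c) := by
  set B : Finset ι := {x : ι | f x ≠ f' x} with hB
  have hinj : #{g : Fin c → ι × κ | (∀ i, (g i).2 = f (g i).1) ∧ ¬ ∀ i, (g i).2 = f' (g i).1} ≤
      #(univ.biUnion fun i : Fin c => ({x : Fin c → ι | x i ∈ B} : Finset (Fin c → ι))) := by
    refine card_le_card_of_injOn (fun g i => (g i).1) (fun g hg => ?_) fun g hg g' hg' h => ?_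
    · simp only [coe_filter, mem_univ, true_and, Set.mem_ofPred_eq, not_forall] at hg
      obtain ⟨hgf, i, hi⟩ := hg
      simp only [hB, coe_biUnion, Set.mem_iUnion, mem_coe, mem_filter, mem_univ, true_and]
      exact ⟨i, trivial, hgf i ▸ hi⟩
    · simp only [coe_filter, mem_univ, true_and, Set.mem_ofPred_eq] at hg hg'
      funext i
      have hi : (g i).1 = (g' i).1 := congrFun h i
      exact Prod.ext hi (by rw [hg.1, hg'.1, hi])
  calc _ ≤ (∑ i : Fin c, #{x : Fin c → ι | x i ∈ B}) * Fintype.card ι :=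
        Nat.mul_le_mul_right _ (hinj.trans card_biUnion_le)
    _ = _ := by
        rw [sum_mul, sum_congr rfl fun i _ => card_filter_apply_mem_mul_card i B]
        simp


/-- If two functions `f, f'` on a domain of size `N` differ on at most `α·N` inputs,
then the `c`-fold tensor database states `⊗ᵢ ∑ₓ |x⟩|f(x)⟩` and `⊗ᵢ ∑ₓ |x⟩|f'(x)⟩`
satisfy `‖ψ − ψ'‖² ≤ 2·c·α`. -/
theorem norm_sq_sub_database_states {ι κ : Type*} [Fintype ι] [Fintype κ]
    [DecidableEq ι] [DecidableEq κ]
    (N : ℕ) (hN : 1 ≤ N) (hcard : Fintype.card ι = N)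
    (c : ℕ) (hc : 0 < c)
    (f f' : ι → κ) (α : ℝ) (hα : 0 ≤ α)
    (hdiff : ((Finset.univ.filter (fun x : ι => f x ≠ f' x)).card : ℝ) ≤ α * N)
    (ψ ψ' : EuclideanSpace ℂ (Fin c → ι × κ))
    (hψ : ∀ g, ψ g =
      if ∀ i, (g i).2 = f (g i).1 then (((N : ℝ) ^ (-(c : ℝ) / 2) : ℝ) : ℂ) else 0)
    (hψ' : ∀ g, ψ' g =
      if ∀ i, (g i).2 = f' (g i).1 then (((N : ℝ) ^ (-(c : ℝ) / 2) : ℝ) : ℂ) else 0) :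
    ‖ψ - ψ'‖ ^ 2 ≤ 2 * c * α := by
  have hN0 : (0 : ℝ) < N := by exact_mod_cast hN
  have hamp : ((N : ℝ) ^ (-(c : ℝ) / 2)) ^ 2 = ((N : ℝ) ^ c)⁻¹ := by
    rw [← Real.rpow_natCast, ← Real.rpow_mul hN0.le, ← Real.rpow_natCast (N : ℝ) c,
      ← Real.rpow_neg hN0.le]
    congr 1
    push_cast
    ring
  have hterm (g : Fin c → ι × κ) : ‖(ψ - ψ') g‖ ^ 2 = ((N : ℝ) ^ c)⁻¹ *
      ((if (∀ i, (g i).2 = f (g i).1) ∧ ¬ ∀ i, (g i).2 = f' (g i).1 then 1 else 0) +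
        (if (∀ i, (g i).2 = f' (g i).1) ∧ ¬ ∀ i, (g i).2 = f (g i).1 then 1 else 0)) := by
    rw [PiLp.sub_apply, hψ, hψ', ← hamp]
    exact norm_sq_ite_sub_ite _ _ _
  have hcount (k k' : ι → κ)
      (hk : ((Finset.univ.filter (fun x : ι => k x ≠ k' x)).card : ℝ) ≤ α * N) :
      ((Finset.univ.filter fun g : Fin c → ι × κ =>
        (∀ i, (g i).2 = k (g i).1) ∧ ¬ ∀ i, (g i).2 = k' (g i).1).card : ℝ) ≤
        c * α * (N : ℝ) ^ c := by
    have h := card_graph_tuples_sdiff_mul_card_le (c := c) k k'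
    rw [hcard, ← Nat.cast_le (α := ℝ)] at h
    push_cast at h
    refine le_of_mul_le_mul_right (h.trans ?_) hN0
    calc _ ≤ (c : ℝ) * ((α * N) * (N : ℝ) ^ c) := by gcongr
      _ = _ := by ring
  have h₁ := hcount f f' hdiff
  have h₂ := hcount f' f (by simpa only [ne_comm] using hdiff)
  rw [EuclideanSpace.norm_sq_eq, Finset.sum_congr rfl fun g _ => hterm g, ← Finset.mul_sum,
    Finset.sum_add_distrib, Finset.sum_boole, Finset.sum_boole, inv_mul_le_iff₀ (by positivity)]
  linarith
end

section
/- Let N, D, T₁, T₂ be natural numbers with D ≥ 1 and D + T₁ + T₂ ≤ N. Writing (m)_D = m·(m−1)···(m−D+1) for the descending factorial, the following inequality holds over the real numbers: ( (N)_D · (N−T₁−T₂)_D ) / ( (N−T₁)_D · (N−T₂)_D ) ≥ ( (N−D+1)·(N−T₁−T₂−D+1) / ( (N−T₁−D+1)·(N−T₂−D+1) ) )^D. -/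
/-- For nonnegative `s` and `t`, the map `x ↦ x (x + s + t) / ((x + s) (x + t))` is monotone on the
positive reals. -/
theorem mul_add_add_div_mul_le {x y s t : ℝ} (hx : 0 < x) (hxy : x ≤ y) (hs : 0 ≤ s) (ht : 0 ≤ t) :
    (x + s + t) * x / ((x + t) * (x + s)) ≤ (y + s + t) * y / ((y + t) * (y + s)) := by
  have hy : 0 < y := hx.trans_le hxy
  rw [div_le_div_iff₀ (by positivity) (by positivity)]
  have hmul : (x + s + t) * x ≤ (y + s + t) * y := by gcongr
  linear_combination (s * t) * hmul

/-- Ratio of descending factorials bounded below by the `D`-th power of the worst factor: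
`(N)_D (N−T₁−T₂)_D / ((N−T₁)_D (N−T₂)_D)
  ≥ ((N−D+1)(N−T₁−T₂−D+1) / ((N−T₁−D+1)(N−T₂−D+1)))^D`. -/
theorem descFactorial_ratio_ge_pow (N D T₁ T₂ : ℕ) (hD : 1 ≤ D) (h : D + T₁ + T₂ ≤ N) :
    ((((N - D + 1) * (N - T₁ - T₂ - D + 1) : ℕ) : ℝ) /
        (((N - T₁ - D + 1) * (N - T₂ - D + 1) : ℕ) : ℝ)) ^ D ≤
      ((N.descFactorial D : ℝ) * ((N - T₁ - T₂).descFactorial D : ℝ)) /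
        (((N - T₁).descFactorial D : ℝ) * ((N - T₂).descFactorial D : ℝ)) := by
  obtain ⟨K, rfl⟩ := Nat.exists_eq_add_of_le h
  simp only [Nat.descFactorial_eq_prod_range, Nat.cast_prod, ← Finset.prod_mul_distrib,
    ← Finset.prod_div_distrib]
  conv_lhs => rw [← Finset.card_range D, ← Finset.prod_const]
  refine Finset.prod_le_prod (fun i _ ↦ by positivity) fun i hi ↦ ?_
  obtain ⟨j, rfl⟩ := Nat.exists_eq_add_of_lt (Finset.mem_range.mp hi)
  have key := mul_add_add_div_mul_le (x := K + 1) (y := K + 1 + j) (s := T₁) (t := T₂)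
    (by positivity) (by simp) (by positivity) (by positivity)
  rw [Finset.card_range]
  rw [show i + j + 1 + T₁ + T₂ + K - (i + j + 1) + 1 = K + 1 + T₁ + T₂ by lia,
    show i + j + 1 + T₁ + T₂ + K - T₁ - T₂ - (i + j + 1) + 1 = K + 1 by lia,
    show i + j + 1 + T₁ + T₂ + K - T₁ - (i + j + 1) + 1 = K + 1 + T₂ by lia,
    show i + j + 1 + T₁ + T₂ + K - T₂ - (i + j + 1) + 1 = K + 1 + T₁ by lia,
    show i + j + 1 + T₁ + T₂ + K - i = K + 1 + j + T₁ + T₂ by lia,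
    show i + j + 1 + T₁ + T₂ + K - T₁ - T₂ - i = K + 1 + j by lia,
    show i + j + 1 + T₁ + T₂ + K - T₁ - i = K + 1 + j + T₂ by lia,
    show i + j + 1 + T₁ + T₂ + K - T₂ - i = K + 1 + j + T₁ by lia]
  exact_mod_cast key
end

section
/- Let N, D, T₁, T₂ be natural numbers with D ≥ 1 and D + T₁ + T₂ ≤ N. Writing (m)_D = m·(m−1)···(m−D+1) for the descending factorial, the following inequality holds over the real numbers: ( (N)_D · (N−T₁−T₂)_D ) / ( (N−T₁)_D · (N−T₂)_D ) ≥ 1 − D·T₁·T₂ / ( (N−D+1)·(N−T₁−T₂−D+1) ). -/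
/-- If every factor lies in `[1 - c, 1]` and is nonnegative, then the product of `k` factors
is at least `1 - k * c`. -/
theorem one_sub_mul_le_prod_range {r : ℕ → ℝ} {c : ℝ} (hc : 0 ≤ c) (k : ℕ)
    (h0 : ∀ i < k, 0 ≤ r i) (h1 : ∀ i < k, r i ≤ 1) (hr : ∀ i < k, 1 - c ≤ r i) :
    1 - k * c ≤ ∏ i ∈ Finset.range k, r i := by
  induction k with
  | zero => simp
  | succ k ih =>
    have hP := ih (fun i hi => h0 i (by lia)) (fun i hi => h1 i (by lia))
      (fun i hi => hr i (by lia))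
    have hP0 : 0 ≤ ∏ i ∈ Finset.range k, r i :=
      Finset.prod_nonneg fun i hi => h0 i (by have := Finset.mem_range.1 hi; lia)
    have hP1 : ∏ i ∈ Finset.range k, r i ≤ 1 :=
      Finset.prod_le_one (fun i hi => h0 i (by have := Finset.mem_range.1 hi; lia))
        fun i hi => h1 i (by have := Finset.mem_range.1 hi; lia)
    rw [Finset.prod_range_succ]
    push_cast
    nlinarith [mul_le_mul_of_nonneg_left (hr k k.lt_succ_self) hP0,
      mul_le_mul_of_nonneg_right hP1 hc]

/-- Casting a falling factorial whose factors do not truncate. -/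
theorem cast_descFactorial_eq_prod_range {n k : ℕ} (h : k ≤ n) :
    (n.descFactorial k : ℝ) = ∏ i ∈ Finset.range k, ((n : ℝ) - i) := by
  rw [Nat.descFactorial_eq_prod_range, Nat.cast_prod]
  refine Finset.prod_congr rfl fun i hi => ?_
  have := Finset.mem_range.1 hi
  exact Nat.cast_sub (by lia)

theorem mul_div_mul_le_one {a b y : ℝ} (ha : 0 ≤ a) (hb : 0 ≤ b) (hy : 0 < y) :
    (y + a + b) * y / ((y + b) * (y + a)) ≤ 1 := by
  rw [div_le_one (by positivity)]
  nlinarith [mul_nonneg ha hb]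

theorem one_sub_div_le_mul_div_mul {a b m y : ℝ} (ha : 0 ≤ a) (hb : 0 ≤ b) (hm : 0 < m)
    (hmy : m ≤ y) :
    1 - a * b / ((m + a + b) * m) ≤ (y + a + b) * y / ((y + b) * (y + a)) := by
  have hy : 0 < y := hm.trans_le hmy
  have hfactor : (y + a + b) * y / ((y + b) * (y + a)) = 1 - a * b / ((y + b) * (y + a)) := by
    rw [eq_sub_iff_add_eq, ← add_div, div_eq_one_iff_eq (by positivity)]
    ring
  have hden : (m + a + b) * m ≤ (y + b) * (y + a) :=
    calc (m + a + b) * m ≤ (y + a + b) * y := by gcongr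
      _ ≤ (y + b) * (y + a) := by nlinarith [mul_nonneg ha hb]
  rw [hfactor]
  exact sub_le_sub_left (div_le_div_of_nonneg_left (mul_nonneg ha hb) (by positivity) hden) 1


/-- The good-transcript ratio bound of the H-coefficient proof of EFX security:
`(N)_D (N−T₁−T₂)_D / ((N−T₁)_D (N−T₂)_D) ≥ 1 − D·T₁·T₂ / ((N−D+1)(N−T₁−T₂−D+1))`. -/
theorem descFactorial_ratio_ge_one_sub (N D T₁ T₂ : ℕ) (hD : 1 ≤ D) (h : D + T₁ + T₂ ≤ N) :
    1 - ((D * T₁ * T₂ : ℕ) : ℝ) / (((N - D + 1) * (N - T₁ - T₂ - D + 1) : ℕ) : ℝ) ≤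
      ((N.descFactorial D : ℝ) * ((N - T₁ - T₂).descFactorial D : ℝ)) /
        (((N - T₁).descFactorial D : ℝ) * ((N - T₂).descFactorial D : ℝ)) := by
  obtain ⟨M, rfl⟩ := Nat.exists_eq_add_of_le h
  have e₁ : D + T₁ + T₂ + M - T₁ - T₂ = D + M := by lia
  have e₂ : D + T₁ + T₂ + M - T₁ = D + T₂ + M := by lia
  have e₃ : D + T₁ + T₂ + M - T₂ = D + T₁ + M := by lia
  have e₄ : D + T₁ + T₂ + M - D + 1 = T₁ + T₂ + M + 1 := by lia
  have e₅ : D + M - D + 1 = M + 1 := by lia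
  rw [e₁, e₂, e₃, e₄, e₅, cast_descFactorial_eq_prod_range (by lia),
    cast_descFactorial_eq_prod_range (by lia), cast_descFactorial_eq_prod_range (by lia),
    cast_descFactorial_eq_prod_range (by lia), ← Finset.prod_mul_distrib,
    ← Finset.prod_mul_distrib, ← Finset.prod_div_distrib]
  push_cast
  have ht₁ : (0 : ℝ) ≤ T₁ := T₁.cast_nonneg
  have ht₂ : (0 : ℝ) ≤ T₂ := T₂.cast_nonneg
  have hi : ∀ i < D, (i : ℝ) + 1 ≤ D := fun i hi => by exact_mod_cast hi
  have hc : (D : ℝ) * T₁ * T₂ / ((T₁ + T₂ + M + 1) * (M + 1))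
      = D * (T₁ * T₂ / ((M + 1 + T₁ + T₂) * (M + 1))) := by
    rw [mul_assoc, mul_div_assoc, show (T₁ : ℝ) + T₂ + M + 1 = M + 1 + T₁ + T₂ by ring]
  have hq : ∀ i : ℕ, ((D : ℝ) + T₁ + T₂ + M - i) * (D + M - i)
      / ((D + T₂ + M - i) * (D + T₁ + M - i))
      = ((D + M - i) + T₁ + T₂) * (D + M - i) / ((D + M - i + T₂) * (D + M - i + T₁)) := by
    intro i
    congr 2 <;> ring
  simp only [hc, hq]
  have hm : (0 : ℝ) < M + 1 := by positivity
  have hmy : ∀ i < D, (M : ℝ) + 1 ≤ D + M - i := fun i h => by linarith [hi i h]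
  have hy : ∀ i < D, (0 : ℝ) < D + M - i := fun i h => hm.trans_le (hmy i h)
  refine one_sub_mul_le_prod_range (by positivity) D (fun i h => ?_)
    (fun i h => mul_div_mul_le_one ht₁ ht₂ (hy i h))
    (fun i h => one_sub_div_le_mul_div_mul ht₁ ht₂ hm (hmy i h))
  have := hy i h
  positivity
end

section
/- Let U = (ZMod 2)^u and W = (ZMod 2)^{n−u} with componentwise addition (bitwise XOR), let K be a type of keys, and let E : K → (U × W) → (U × W) be a family of functions. Fix a key k ∈ K and whitening keys k₁ = (k₁ˡ, k₁ʳ) ∈ U × W and k₂ ∈ U × W, and define the FX cipher FX(v) = E(k)(v + k₁) + k₂ for v ∈ U × W. Define G : U → U × W by G(x) = FX(x, 0) + E(k)(x, k₁ʳ). Then G is periodic with period k₁ˡ: for every x ∈ U, G(x + k₁ˡ) = G(x). -/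
/-- Reduced-codebook hidden period for the offline-Simon attack on FX:
`G(x) = FX(x‖0) ⊕ E_k(x‖k₁ʳ)` satisfies `G(x ⊕ k₁ˡ) = G(x)` for all `x`. -/
theorem fx_reduced_codebook_hidden_period (u n : ℕ) {K : Type*}
    (E : K → (Fin u → ZMod 2) × (Fin (n - u) → ZMod 2) →
      (Fin u → ZMod 2) × (Fin (n - u) → ZMod 2))
    (k : K) (k₁l : Fin u → ZMod 2) (k₁r : Fin (n - u) → ZMod 2)
    (k₂ : (Fin u → ZMod 2) × (Fin (n - u) → ZMod 2))
    (FX : (Fin u → ZMod 2) × (Fin (n - u) → ZMod 2) →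
      (Fin u → ZMod 2) × (Fin (n - u) → ZMod 2))
    (hFX : ∀ v, FX v = E k (v + (k₁l, k₁r)) + k₂)
    (G : (Fin u → ZMod 2) → (Fin u → ZMod 2) × (Fin (n - u) → ZMod 2))
    (hG : ∀ x, G x = FX (x, 0) + E k (x, k₁r)) :
    ∀ x, G (x + k₁l) = G x := by
  intro x
  have hk : k₁l + k₁l = 0 := funext fun i => CharTwo.add_self_eq_zero (k₁l i)
  simp only [hG, hFX, Prod.mk_add_mk, zero_add, add_assoc, hk, add_zero]
  abel
end

section
/- Let U = (ZMod 2)^u and W = (ZMod 2)^{n−u} with componentwise addition (bitwise XOR), and set V = U × W. Let E¹ : V → V be any function, let E² : V → V be a bijection, and fix whitening keys k₁ = (k₁ˡ, k₁ʳ) ∈ V and k₂ ∈ V. Define the EFX cipher EFX(x) = E²(k₂ + E¹(k₁ + x)) for x ∈ V, and define g : U → V by g(x) = (E²)⁻¹(EFX(x, 0)) + E¹(x, k₁ʳ). Then g is periodic with period k₁ˡ: for every x ∈ U, g(x + k₁ˡ) = g(x). -/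
/-- Hidden period for the offline-Simon attack on EFX (2XOR-Cascade):
`g(x) = (E²)⁻¹(EFX(x‖0)) ⊕ E¹(x‖k₁ʳ)` satisfies `g(x ⊕ k₁ˡ) = g(x)` for all `x`. -/
theorem efx_hidden_period (u n : ℕ)
    (E₁ : (Fin u → ZMod 2) × (Fin (n - u) → ZMod 2) →
      (Fin u → ZMod 2) × (Fin (n - u) → ZMod 2))
    (E₂ : ((Fin u → ZMod 2) × (Fin (n - u) → ZMod 2)) ≃
      ((Fin u → ZMod 2) × (Fin (n - u) → ZMod 2)))
    (k₁l : Fin u → ZMod 2) (k₁r : Fin (n - u) → ZMod 2)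
    (k₂ : (Fin u → ZMod 2) × (Fin (n - u) → ZMod 2))
    (EFX : (Fin u → ZMod 2) × (Fin (n - u) → ZMod 2) →
      (Fin u → ZMod 2) × (Fin (n - u) → ZMod 2))
    (hEFX : ∀ x, EFX x = E₂ (k₂ + E₁ ((k₁l, k₁r) + x)))
    (g : (Fin u → ZMod 2) → (Fin u → ZMod 2) × (Fin (n - u) → ZMod 2))
    (hg : ∀ x, g x = E₂.symm (EFX (x, 0)) + E₁ (x, k₁r)) :
    ∀ x, g (x + k₁l) = g x := by
  intro x
  have hself : k₁l + k₁l = 0 := funext fun i => CharTwo.add_self_eq_zero (k₁l i)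
  have hk : k₁l + (x + k₁l) = x := by
    rw [add_left_comm, hself, add_zero]
  simp only [hg, hEFX, Equiv.symm_apply_apply, Prod.mk_add_mk, add_zero, hk]
  rw [add_comm x k₁l, add_right_comm]
end
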